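/- arXiv:1601.04182 — 3 statements merged into one kernel-verified Lean document; each statement's English description precedes it below -/
import Mathlib

section
/- Let Φ₀ : (0, ∞) → [0, ∞) satisfy (P1), (P2) and (P3), with exponent β > 2 and threshold r₀ ∈ (0,1). Let E₀ > 0 and 0 ≤ A₀ < 2E₀. Then there exist a constant C > 0 and a threshold ε₀ ∈ (0, 1), both depending only on E₀, A₀ and Φ₀, such that for every ε ∈ (0, ε₀]: whenever ρ* ∈ (r₀, 1) satisfies A₀/ρ*² + 4ε⁻¹Φ₀(ρ*) = 2E₀, the time of closest approach satisfies ∫_{ρ*}^{1} dr / √(2E₀ − A₀/r² − 4ε⁻¹Φ₀(r)) ≤ C ε^{1/β}. -/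
/-- Under assumptions (P1), (P2), (P3) on the reference potential `Φ₀`, there are a
constant `C > 0` and a threshold `ε₀ ∈ (0,1)`, depending only on `E₀`, `A₀` and `Φ₀`,
such that for all `0 < ε ≤ ε₀`: whenever `ρ* ∈ (r₀, 1)` solves the closest-approach
equation `A₀/ρ*² + 4ε⁻¹Φ₀(ρ*) = 2E₀`, the time of closest approach satisfies
`∫_{ρ*}^{1} dr/√(2E₀ − A₀/r² − 4ε⁻¹Φ₀(r)) ≤ C ε^{1/β}`. -/
theorem time_of_closest_approach_bound
    (Φ₀ dΦ₀ d2Φ₀ : ℝ → ℝ)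
    -- (P1)
    (hΦnn : ∀ r : ℝ, 0 < r → 0 ≤ Φ₀ r)
    (hd1 : ∀ r : ℝ, 0 < r → HasDerivAt Φ₀ (dΦ₀ r) r)
    (hd2 : ∀ r : ℝ, 0 < r → HasDerivAt dΦ₀ (d2Φ₀ r) r)
    (hd2cont : ContinuousOn d2Φ₀ (Set.Ioi 0))
    (hsupp : ∀ r : ℝ, 1 ≤ r → Φ₀ r = 0)
    (hdec : ∀ r : ℝ, 0 < r → r < 1 → dΦ₀ r < 0)
    (hconv : ∀ r : ℝ, 0 < r → r < 1 → 0 < d2Φ₀ r)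
    (hblow : Filter.Tendsto Φ₀ (nhdsWithin 0 (Set.Ioi 0)) Filter.atTop)
    -- (P2)
    (c₁ c₂ β r₀ : ℝ)
    (hc₁ : 0 < c₁) (hc₁₂ : c₁ < c₂) (hβ : 2 < β) (hr₀ : 0 < r₀) (hr₀1 : r₀ < 1)
    (hP2 : ∀ r : ℝ, r₀ ≤ r → r ≤ 1 →
      c₁ * (1 - r) ^ β ≤ Φ₀ r ∧ Φ₀ r ≤ c₂ * (1 - r) ^ β)
    -- (P3)
    (κ₁ κ₂ : ℝ) (hκ₁ : 0 < κ₁) (hκ₁₂ : κ₁ < κ₂)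
    (hP3 : ∀ r : ℝ, r₀ ≤ r → r ≤ 1 →
      κ₁ * (1 - r) ^ (β - 1) ≤ |dΦ₀ r| ∧ |dΦ₀ r| ≤ κ₂ * (1 - r) ^ (β - 1))
    (E₀ A₀ : ℝ) (hE₀ : 0 < E₀) (hA₀ : 0 ≤ A₀) (hAE : A₀ < 2 * E₀) :
    ∃ C : ℝ, 0 < C ∧ ∃ ε₀ : ℝ, ε₀ ∈ Set.Ioo (0 : ℝ) 1 ∧
      ∀ ε : ℝ, ε ∈ Set.Ioc 0 ε₀ →
        ∀ ρstar : ℝ, ρstar ∈ Set.Ioo r₀ 1 →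
          A₀ / ρstar ^ 2 + 4 * ε⁻¹ * Φ₀ ρstar = 2 * E₀ →
          (∫ r in ρstar..1,
              (Real.sqrt (2 * E₀ - A₀ / r ^ 2 - 4 * ε⁻¹ * Φ₀ r))⁻¹)
            ≤ C * ε ^ (1/β) := by
  have hm : 0 < 2 * E₀ - A₀ := by linarith
  refine ⟨2 / √(2 * E₀ - A₀) * (E₀ / (2 * c₁)) ^ (1 / β), by positivity, 1 / 2,
    ⟨by norm_num, by norm_num⟩, ?_⟩
  rintro ε ⟨hε, -⟩ ρ ⟨hρ0, hρ1⟩ heq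
  have hρ : 0 < ρ := hr₀.trans hρ0
  have hL : 0 < 1 - ρ := by linarith
  have hcvx : ConvexOn ℝ (Set.Icc ρ 1) Φ₀ := by
    apply convexOn_of_hasDerivWithinAt2_nonneg (f' := dΦ₀) (f'' := d2Φ₀) (convex_Icc ρ 1)
    · intro x hx
      exact (hd1 x (hρ.trans_le hx.1)).continuousAt.continuousWithinAt
    · intro x hx
      rw [interior_Icc] at hx
      exact (hd1 x (hρ.trans hx.1)).hasDerivWithinAt
    · intro x hx
      rw [interior_Icc] at hx
      exact (hd2 x (hρ.trans hx.1)).hasDerivWithinAt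
    · intro x hx
      rw [interior_Icc] at hx
      exact (hconv x (hρ.trans hx.1) hx.2).le
  have hpow : ConvexOn ℝ (Set.Ioi (0:ℝ)) (fun x : ℝ => x ^ (-2 : ℤ)) := convexOn_zpow (-2)
  have hlow : ∀ r, ρ < r → r ≤ 1 →
      (2 * E₀ - A₀) / (1 - ρ) * (r - ρ) ≤ 2 * E₀ - A₀ / r ^ 2 - 4 * ε⁻¹ * Φ₀ r := by
    intro r hr hr1
    have ha : 0 ≤ (1 - r) / (1 - ρ) := div_nonneg (by linarith) hL.le
    have hb : 0 ≤ (r - ρ) / (1 - ρ) := div_nonneg (by linarith) hL.le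
    have hab : (1 - r) / (1 - ρ) + (r - ρ) / (1 - ρ) = 1 := by field_simp; ring
    have hcomb : (1 - r) / (1 - ρ) * ρ + (r - ρ) / (1 - ρ) * 1 = r := by field_simp; ring
    have h1 := hcvx.2 (⟨le_rfl, hρ1.le⟩ : ρ ∈ Set.Icc ρ 1) (⟨hρ1.le, le_rfl⟩ : (1:ℝ) ∈ Set.Icc ρ 1)
      ha hb hab
    have h2 := hpow.2 (show ρ ∈ Set.Ioi (0:ℝ) from hρ) (show (1:ℝ) ∈ Set.Ioi (0:ℝ) from Set.mem_Ioi.2 one_pos)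
      ha hb hab
    simp only [smul_eq_mul] at h1 h2
    rw [hcomb, hsupp 1 le_rfl] at h1
    rw [hcomb] at h2
    have e : ∀ x : ℝ, x ^ (-2 : ℤ) = (x ^ 2)⁻¹ := fun x => by rw [zpow_neg]; norm_cast
    rw [e, e, e] at h2
    generalize hA : (1 - r) / (1 - ρ) = a at *
    have hB : (2 * E₀ - A₀) / (1 - ρ) * (r - ρ) = (2 * E₀ - A₀) * ((r - ρ) / (1 - ρ)) := by ring
    rw [hB]
    generalize (r - ρ) / (1 - ρ) = b at *
    have h3 := mul_le_mul_of_nonneg_left h2 hA₀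
    have h4 := mul_le_mul_of_nonneg_left h1 (by positivity : 0 ≤ 4 * ε⁻¹)
    rw [div_eq_mul_inv] at heq ⊢
    have h5 : b = 1 - a := by linarith
    subst h5
    have h6 := congrArg (fun z => a * z) heq
    ring_nf at h3 h4 h6 ⊢
    linarith
  have hint : IntervalIntegrable (fun r : ℝ => √((1 - ρ) / (2 * E₀ - A₀)) * (r - ρ) ^ (-(1/2) : ℝ))
      MeasureTheory.volume ρ 1 := by
    have h := (intervalIntegral.intervalIntegrable_rpow' (a := 0) (b := 1 - ρ)
      (by norm_num : (-1:ℝ) < -(1/2))).comp_sub_right ρ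
    simp only [zero_add, sub_add_cancel] at h
    exact h.const_mul _
  have hval : (∫ r in ρ..1, √((1 - ρ) / (2 * E₀ - A₀)) * (r - ρ) ^ (-(1/2) : ℝ))
      = 2 / √(2 * E₀ - A₀) * (1 - ρ) := by
    rw [intervalIntegral.integral_const_mul,
      intervalIntegral.integral_comp_sub_right (fun x : ℝ => x ^ (-(1/2) : ℝ)) ρ,
      integral_rpow (Or.inl (by norm_num)), sub_self]
    norm_num
    rw [← Real.sqrt_eq_rpow, Real.sqrt_div hL.le]
    have := Real.mul_self_sqrt hL.le
    linear_combination (2 / √(2 * E₀ - A₀)) * this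
  have hmono : (∫ r in ρ..1, (√(2 * E₀ - A₀ / r ^ 2 - 4 * ε⁻¹ * Φ₀ r))⁻¹)
      ≤ ∫ r in ρ..1, √((1 - ρ) / (2 * E₀ - A₀)) * (r - ρ) ^ (-(1/2) : ℝ) := by
    rw [intervalIntegral.integral_of_le hρ1.le, intervalIntegral.integral_of_le hρ1.le]
    apply MeasureTheory.integral_mono_of_nonneg
    · exact Filter.Eventually.of_forall fun r => by positivity
    · exact (intervalIntegrable_iff_integrableOn_Ioc_of_le hρ1.le).1 hint
    · filter_upwards [MeasureTheory.ae_restrict_mem measurableSet_Ioc] with r hr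
      have hrp : 0 < r - ρ := by linarith [hr.1]
      have h := hlow r hr.1 hr.2
      have hpos : 0 < (2 * E₀ - A₀) / (1 - ρ) * (r - ρ) := by positivity
      calc (√(2 * E₀ - A₀ / r ^ 2 - 4 * ε⁻¹ * Φ₀ r))⁻¹
          ≤ (√((2 * E₀ - A₀) / (1 - ρ) * (r - ρ)))⁻¹ :=
            inv_anti₀ (Real.sqrt_pos.2 hpos) (Real.sqrt_le_sqrt h)
        _ = _ := by
            rw [Real.sqrt_mul (by positivity), mul_inv, ← Real.sqrt_inv, inv_div,
              Real.rpow_neg hrp.le, ← Real.sqrt_eq_rpow]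
  have hbd : 1 - ρ ≤ (E₀ / (2 * c₁)) ^ (1 / β) * ε ^ (1 / β) := by
    rw [← Real.mul_rpow (by positivity) hε.le, one_div β,
      Real.le_rpow_inv_iff_of_pos hL.le (by positivity) (by linarith)]
    have h1 := (hP2 ρ hρ0.le hρ1.le).1
    have h2 : 0 ≤ A₀ / ρ ^ 2 := by positivity
    have h3 : 4 * ε⁻¹ * Φ₀ ρ ≤ 2 * E₀ := by linarith
    have h4 : Φ₀ ρ ≤ E₀ * ε / 2 := by
      have h5 := mul_le_mul_of_nonneg_left h3 hε.le
      have h6 : ε * (4 * ε⁻¹ * Φ₀ ρ) = 4 * Φ₀ ρ := by field_simp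
      linarith
    rw [show E₀ / (2 * c₁) * ε = (E₀ * ε / 2) / c₁ by field_simp, le_div_iff₀ hc₁]
    linarith
  calc _ ≤ _ := hmono
    _ = _ := hval
    _ ≤ 2 / √(2 * E₀ - A₀) * ((E₀ / (2 * c₁)) ^ (1 / β) * ε ^ (1 / β)) := by gcongr
    _ = _ := by ring
end

section
/- Let Φ₀ : (0, ∞) → [0, ∞) satisfy (P1), (P2) and (P3), with exponent β > 2 and threshold r₀ ∈ (0,1). Let E₀ > 0 and 0 < A₀ < 2E₀, and for each ε ∈ (0,1) let ρ*^ε ∈ (0,1) be the unique solution of A₀/ρ² + 4ε⁻¹Φ₀(ρ) = 2E₀. Then the deflection-angle increment tends to zero in the hardening limit: lim_{ε→0} ∫_{ρ*^ε}^{1} √A₀ / ( r² √(2E₀ − A₀/r² − 4ε⁻¹Φ₀(r)) ) dr = 0. Consequently the deflection angle ϑ*^ε converges to the initial angle ϑ₀, and the apse line ω*^ε converges to y₀ = x₀ − x̄₀ as ε → 0. -/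
/-- In the hardening limit `ε → 0⁺`, the deflection-angle increment
`∫_{ρ*^ε}^{1} √A₀/(r²√(2E₀ − A₀/r² − 4ε⁻¹Φ₀(r))) dr` tends to zero, so the
deflection angle converges to the initial angle and the apse line converges to
`y₀ = x₀ − x̄₀`. -/
theorem deflection_angle_vanishes_in_hardening_limit
    (Φ₀ dΦ₀ d2Φ₀ : ℝ → ℝ)
    -- (P1)
    (hΦnn : ∀ r : ℝ, 0 < r → 0 ≤ Φ₀ r)
    (hd1 : ∀ r : ℝ, 0 < r → HasDerivAt Φ₀ (dΦ₀ r) r)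
    (hd2 : ∀ r : ℝ, 0 < r → HasDerivAt dΦ₀ (d2Φ₀ r) r)
    (hd2cont : ContinuousOn d2Φ₀ (Set.Ioi 0))
    (hsupp : ∀ r : ℝ, 1 ≤ r → Φ₀ r = 0)
    (hdec : ∀ r : ℝ, 0 < r → r < 1 → dΦ₀ r < 0)
    (hconv : ∀ r : ℝ, 0 < r → r < 1 → 0 < d2Φ₀ r)
    (hblow : Filter.Tendsto Φ₀ (nhdsWithin 0 (Set.Ioi 0)) Filter.atTop)
    -- (P2)
    (c₁ c₂ β r₀ : ℝ)
    (hc₁ : 0 < c₁) (hc₁₂ : c₁ < c₂) (hβ : 2 < β) (hr₀ : 0 < r₀) (hr₀1 : r₀ < 1)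
    (hP2 : ∀ r : ℝ, r₀ ≤ r → r ≤ 1 →
      c₁ * (1 - r) ^ β ≤ Φ₀ r ∧ Φ₀ r ≤ c₂ * (1 - r) ^ β)
    -- (P3)
    (κ₁ κ₂ : ℝ) (hκ₁ : 0 < κ₁) (hκ₁₂ : κ₁ < κ₂)
    (hP3 : ∀ r : ℝ, r₀ ≤ r → r ≤ 1 →
      κ₁ * (1 - r) ^ (β - 1) ≤ |dΦ₀ r| ∧ |dΦ₀ r| ≤ κ₂ * (1 - r) ^ (β - 1))
    (E₀ A₀ : ℝ) (hE₀ : 0 < E₀) (hA₀ : 0 < A₀) (hAE : A₀ < 2 * E₀)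
    (ρstar : ℝ → ℝ)
    (hρ : ∀ ε : ℝ, ε ∈ Set.Ioo (0 : ℝ) 1 →
      ρstar ε ∈ Set.Ioo (0 : ℝ) 1 ∧
      A₀ / ρstar ε ^ 2 + 4 * ε⁻¹ * Φ₀ (ρstar ε) = 2 * E₀) :
    Filter.Tendsto
      (fun ε : ℝ => ∫ r in ρstar ε..1,
        Real.sqrt A₀ /
          (r ^ 2 * Real.sqrt (2 * E₀ - A₀ / r ^ 2 - 4 * ε⁻¹ * Φ₀ r)))
      (nhdsWithin 0 (Set.Ioi 0)) (nhds 0) := by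
  have hanti : StrictAntiOn Φ₀ (Set.Ioc 0 1) := by
    apply strictAntiOn_of_deriv_neg (convex_Ioc 0 1)
    · intro x hx
      exact (hd1 x hx.1).continuousAt.continuousWithinAt
    · intro x hx
      rw [interior_Ioc] at hx
      rw [(hd1 x hx.1).deriv]
      exact hdec x hx.1 hx.2
  have hev : ∀ᶠ ε : ℝ in nhdsWithin 0 (Set.Ioi 0), ε ∈ Set.Ioo (0 : ℝ) 1 :=
    Ioo_mem_nhdsGT one_pos
  -- the closest approach tends to one
  have hlow : ∀ a : ℝ, 0 < a → a < 1 →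
      ∀ᶠ ε : ℝ in nhdsWithin 0 (Set.Ioi 0), a < ρstar ε := by
    intro a ha0 ha1
    have hpos : 0 < Φ₀ a := by
      have := hanti (a := a) (b := 1) ⟨ha0, ha1.le⟩ ⟨one_pos, le_rfl⟩ ha1
      rwa [hsupp 1 le_rfl] at this
    have hq : 0 < 2 * Φ₀ a / E₀ := by positivity
    have hev2 : ∀ᶠ ε : ℝ in nhdsWithin 0 (Set.Ioi 0), ε ∈ Set.Ioo (0 : ℝ) (2 * Φ₀ a / E₀) :=
      Ioo_mem_nhdsGT hq
    filter_upwards [hev, hev2] with ε h1 h2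
    obtain ⟨hm, he⟩ := hρ ε h1
    by_contra hcon
    push Not at hcon
    have h3 : Φ₀ a ≤ Φ₀ (ρstar ε) :=
      hanti.antitoneOn ⟨hm.1, hm.2.le⟩ ⟨ha0, ha1.le⟩ hcon
    have h4 : 0 < A₀ / ρstar ε ^ 2 := by have := hm.1; positivity
    have hε := h1.1
    have h5 : 4 * ε⁻¹ * Φ₀ (ρstar ε) < 2 * E₀ := by linarith
    have h6 : 4 * Φ₀ (ρstar ε) < 2 * E₀ * ε := by
      have : 4 * ε⁻¹ * Φ₀ (ρstar ε) * ε < 2 * E₀ * ε := mul_lt_mul_of_pos_right h5 hε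
      have h7 : 4 * ε⁻¹ * Φ₀ (ρstar ε) * ε = 4 * Φ₀ (ρstar ε) := by field_simp
      linarith
    have h8 := h2.2
    rw [lt_div_iff₀ hE₀] at h8
    nlinarith
  have hlim : Filter.Tendsto ρstar (nhdsWithin 0 (Set.Ioi 0)) (nhds 1) := by
    rw [tendsto_order]
    constructor
    · intro a ha
      filter_upwards [hlow (max a (1 / 2)) (by positivity) (max_lt ha (by norm_num))] with ε h
      exact lt_of_le_of_lt (le_max_left _ _) h
    · intro a ha
      filter_upwards [hev] with ε h
      exact (hρ ε h).1.2.trans ha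
  have hbd : Filter.Tendsto (fun ε => 16 * Real.sqrt (1 - ρstar ε))
      (nhdsWithin 0 (Set.Ioi 0)) (nhds 0) := by
    have : Filter.Tendsto (fun ε => 16 * Real.sqrt (1 - ρstar ε))
      (nhdsWithin 0 (Set.Ioi 0)) (nhds (16 * Real.sqrt (1 - 1))) :=
      ((tendsto_const_nhds.sub hlim).sqrt).const_mul 16
    simpa using this
  refine squeeze_zero_norm' ?_ hbd
  filter_upwards [hev, hlow (1 / 2) (by norm_num) (by norm_num)] with ε h1 h2
  obtain ⟨⟨hm0, hm1⟩, he⟩ := hρ ε h1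
  have hε := h1.1
  generalize ρstar ε = ρ at *
  have hii : IntervalIntegrable (fun x : ℝ => x ^ (-(1 / 2) : ℝ)) MeasureTheory.volume
      (ρ - ρ) (1 - ρ) := intervalIntegral.intervalIntegrable_rpow' (by norm_num)
  have hii2 : IntervalIntegrable (fun x : ℝ => 8 * (x - ρ) ^ (-(1 / 2) : ℝ))
      MeasureTheory.volume ρ 1 := by
    have := (hii.comp_sub_right ρ).const_mul 8
    simpa using this
  have hval : ∫ x in ρ..1, 8 * (x - ρ) ^ (-(1 / 2) : ℝ) = 16 * Real.sqrt (1 - ρ) := by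
    rw [intervalIntegral.integral_const_mul,
      intervalIntegral.integral_comp_sub_right (fun x : ℝ => x ^ (-(1 / 2) : ℝ)) ρ,
      integral_rpow (Or.inl (by norm_num)), sub_self, Real.sqrt_eq_rpow]
    norm_num
    ring
  rw [← hval]
  refine intervalIntegral.norm_integral_le_of_norm_le hm1.le ?_ hii2
  refine Filter.Eventually.of_forall fun r hr => ?_
  obtain ⟨hr1, hr2⟩ := hr
  have hr0 : 0 < r := hm0.trans hr1
  have hx : 0 < r - ρ := sub_pos.2 hr1
  rw [Real.norm_of_nonneg (by positivity), Real.rpow_neg hx.le, ← Real.sqrt_eq_rpow,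
    ← div_eq_mul_inv]
  have hΦ : Φ₀ r ≤ Φ₀ ρ := hanti.antitoneOn ⟨hm0, hm1.le⟩ ⟨hr0, hr2⟩ hr1.le
  have hΦ2 : 4 * ε⁻¹ * Φ₀ r ≤ 4 * ε⁻¹ * Φ₀ ρ := by gcongr
  have hG : A₀ * (r - ρ) ≤ 2 * E₀ - A₀ / r ^ 2 - 4 * ε⁻¹ * Φ₀ r := by
    have h3 : A₀ / ρ ^ 2 - A₀ / r ^ 2 = A₀ * (r - ρ) * ((r + ρ) / (r ^ 2 * ρ ^ 2)) := by
      field_simp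
      ring
    have h4 : 1 ≤ (r + ρ) / (r ^ 2 * ρ ^ 2) := by
      rw [one_le_div (by positivity)]
      have : r ^ 2 * ρ ^ 2 ≤ 1 * 1 := by
        gcongr
        · nlinarith
        · nlinarith
      linarith
    have h5 : 0 < A₀ * (r - ρ) := by positivity
    nlinarith
  have hS : Real.sqrt A₀ * Real.sqrt (r - ρ) ≤
      Real.sqrt (2 * E₀ - A₀ / r ^ 2 - 4 * ε⁻¹ * Φ₀ r) := by
    rw [← Real.sqrt_mul hA₀.le]
    exact Real.sqrt_le_sqrt hG
  have hsA : 0 < Real.sqrt A₀ := Real.sqrt_pos.2 hA₀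
  have hsx : 0 < Real.sqrt (r - ρ) := Real.sqrt_pos.2 hx
  have hr4 : 1 / 4 ≤ r ^ 2 := by nlinarith
  have hfin : 1 / 4 * (Real.sqrt A₀ * Real.sqrt (r - ρ)) ≤
      r ^ 2 * Real.sqrt (2 * E₀ - A₀ / r ^ 2 - 4 * ε⁻¹ * Φ₀ r) :=
    mul_le_mul hr4 hS (by positivity) (by positivity)
  refine (div_le_div_of_nonneg_left hsA.le (by positivity) hfin).trans ?_
  have h4 : Real.sqrt A₀ / (1 / 4 * (Real.sqrt A₀ * Real.sqrt (r - ρ))) =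
      4 / Real.sqrt (r - ρ) := by field_simp
  rw [h4]
  exact div_le_div_of_nonneg_right (by norm_num) hsx.le
end

section
/- Let Φ₀ : (0, ∞) → [0, ∞) satisfy (P3): there exist constants 0 < κ₁ < κ₂, β > 2 and 0 < r₀ < 1 with κ₁(1−r)^{β−1} ≤ |Φ₀'(r)| ≤ κ₂(1−r)^{β−1} for all r₀ ≤ r ≤ 1. Let q₁ > 0 and C₀ > 0. Suppose ε ∈ (0,1), τ ≥ 0 with τ ≤ C₀ ε^{1/β}, and let ρ : [0, 2τ] → ℝ be continuous with 1 ≥ ρ(t) ≥ 1 − q₁ ε^{1/β} and ρ(t) ≥ r₀ for all t ∈ [0, 2τ]. Then the total impulse of the interaction force is bounded uniformly in ε: ∫₀^{2τ} (4/ε) |Φ₀'(ρ(t))| dt ≤ 8 C₀ κ₂ q₁^{β−1}. -/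
/-- Uniform-in-`ε` bound on the total impulse of the soft-sphere interaction force:
under (P3), if the collision lasts a time `2τ ≤ 2C₀ε^{1/β}` during which the radial
distance stays in `[max(r₀, 1 − q₁ε^{1/β}), 1]`, then
`∫₀^{2τ} (4/ε)|Φ₀'(ρ(t))| dt ≤ 8C₀κ₂q₁^{β−1}`. -/
theorem impulse_bound_uniform_in_epsilon
    (dΦ₀ : ℝ → ℝ)
    (κ₁ κ₂ β r₀ : ℝ)
    (hκ₁ : 0 < κ₁) (hκ₁₂ : κ₁ < κ₂) (hβ : 2 < β) (hr₀ : 0 < r₀) (hr₀1 : r₀ < 1)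
    (hP3 : ∀ r : ℝ, r₀ ≤ r → r ≤ 1 →
      κ₁ * (1 - r) ^ (β - 1) ≤ |dΦ₀ r| ∧ |dΦ₀ r| ≤ κ₂ * (1 - r) ^ (β - 1))
    (q₁ C₀ : ℝ) (hq₁ : 0 < q₁) (hC₀ : 0 < C₀)
    (ε τ : ℝ) (hε : ε ∈ Set.Ioo (0 : ℝ) 1) (hτ : 0 ≤ τ)
    (hτbound : τ ≤ C₀ * ε ^ (1/β))
    (ρ : ℝ → ℝ)
    (hρcont : ContinuousOn ρ (Set.Icc 0 (2 * τ)))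
    (hρub : ∀ t ∈ Set.Icc 0 (2 * τ), ρ t ≤ 1)
    (hρlb : ∀ t ∈ Set.Icc 0 (2 * τ), 1 - q₁ * ε ^ (1/β) ≤ ρ t)
    (hρr₀ : ∀ t ∈ Set.Icc 0 (2 * τ), r₀ ≤ ρ t) :
    (∫ t in (0 : ℝ)..(2 * τ), 4 / ε * |dΦ₀ (ρ t)|)
      ≤ 8 * C₀ * κ₂ * q₁ ^ (β - 1) := by
  obtain ⟨hε0, _⟩ := hε
  have hκ₂ : 0 < κ₂ := hκ₁.trans hκ₁₂
  have hspos : 0 < ε ^ (1/β) := Real.rpow_pos_of_pos hε0 _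
  have hsβ : (ε ^ (1/β)) ^ (β - 1) * ε ^ (1/β) = ε := by
    rw [← Real.rpow_mul hε0.le, ← Real.rpow_add hε0]
    have : 1 / β * (β - 1) + 1 / β = 1 := by
      have : β ≠ 0 := by linarith
      field_simp
      ring
    rw [this, Real.rpow_one]
  generalize ε ^ (1/β) = s at *
  have hbound : ∀ t ∈ Set.uIoc 0 (2 * τ),
      ‖4 / ε * |dΦ₀ (ρ t)|‖ ≤ 4 / ε * (κ₂ * (q₁ * s) ^ (β - 1)) := by
    intro t ht
    rw [Set.uIoc_of_le (by linarith)] at ht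
    have ht' : t ∈ Set.Icc 0 (2 * τ) := Set.Ioc_subset_Icc_self ht
    have h1 := (hP3 (ρ t) (hρr₀ t ht') (hρub t ht')).2
    have h2 : (1 - ρ t) ^ (β - 1) ≤ (q₁ * s) ^ (β - 1) :=
      Real.rpow_le_rpow (by linarith [hρub t ht']) (by linarith [hρlb t ht']) (by linarith)
    rw [Real.norm_of_nonneg (by positivity)]
    exact mul_le_mul_of_nonneg_left
      (h1.trans (mul_le_mul_of_nonneg_left h2 hκ₂.le)) (by positivity)
  have h := intervalIntegral.norm_integral_le_of_norm_le_const hbound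
  rw [sub_zero, abs_of_nonneg (by linarith : 0 ≤ 2 * τ)] at h
  refine (le_abs_self _).trans (h.trans ?_)
  calc 4 / ε * (κ₂ * (q₁ * s) ^ (β - 1)) * (2 * τ)
      ≤ 4 / ε * (κ₂ * (q₁ * s) ^ (β - 1)) * (2 * (C₀ * s)) := by gcongr
    _ = 8 * C₀ * κ₂ * q₁ ^ (β - 1) * ((s ^ (β - 1) * s) / ε) := by
        rw [Real.mul_rpow hq₁.le hspos.le]; ring
    _ = 8 * C₀ * κ₂ * q₁ ^ (β - 1) := by
        rw [hsβ, div_self hε0.ne', mul_one]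
end
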